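/- Let M=(Q,Σ,μ,F) be a dwta over the commutative semifield S whose states are all live, let sol assign to every ∼_M-class B a context sol(B)∈C_Σ(Q) that is a sign of life for every state in B with sol(B)=□ whenever B⊆F, let λ(q) = h_μ^{(2)}(sol([q]_{∼_M})[q]) for every q∈Q, and let μ' be the transition weight assignment of push_λ(M). Then for every σ∈Σ_k and all states with q_i ≡_M q'_i for every i∈[1,k], the weights of the corresponding pushed transitions coincide: (μ')^{(2)}(σ(q_1,…,q_k)) = (μ')^{(2)}(σ(q'_1,…,q'_k)) (both sides being undefined simultaneously). -/

import Mathlib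

open scoped BigOperators Classical

namespace WTA

/-- Trees over a ranked alphabet `Sig` (with arity map `ar`), indexed by states `Q`. -/
inductive PTree (Sig : Type) (ar : Sig → ℕ) (Q : Type) : Type where
  | state : Q → PTree Sig ar Q
  | node : (s : Sig) → (Fin (ar s) → PTree Sig ar Q) → PTree Sig ar Q

/-- Contexts: trees with exactly one occurrence of the hole `□` at a leaf. -/
inductive Ctx (Sig : Type) (ar : Sig → ℕ) (Q : Type) : Type where
  | hole : Ctx Sig ar Q
  | node : (s : Sig) → (i : Fin (ar s)) → (Fin (ar s) → PTree Sig ar Q) →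
      Ctx Sig ar Q → Ctx Sig ar Q

variable {Sig Q Q' S : Type} {ar : Sig → ℕ}

/-- Substitution `c[t]` of a tree into the hole of a context. -/
def Ctx.subst : Ctx Sig ar Q → PTree Sig ar Q → PTree Sig ar Q
  | .hole, t => t
  | .node s i ts c, t => .node s (Function.update ts i (c.subst t))

/-- A closed tree (over `T_Σ`) viewed as a tree indexed by `Q`. -/
def PTree.ofClosed : PTree Sig ar Empty → PTree Sig ar Q
  | .state e => e.elim
  | .node s ts => .node s fun i => (ts i).ofClosed

/-- A closed context viewed as a context with states in `Q`. -/
def Ctx.ofClosed : Ctx Sig ar Empty → Ctx Sig ar Q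
  | .hole => .hole
  | .node s i ts c => .node s i (fun j => (ts j).ofClosed) c.ofClosed

/-- Renaming of the states occurring in a tree. -/
def PTree.rename (g : Q → Q') : PTree Sig ar Q → PTree Sig ar Q'
  | .state p => .state (g p)
  | .node s ts => .node s fun i => (ts i).rename g

/-- Renaming of the states occurring in a context. -/
def Ctx.rename (g : Q → Q') : Ctx Sig ar Q → Ctx Sig ar Q'
  | .hole => .hole
  | .node s i ts c => .node s i (fun j => (ts j).rename g) (c.rename g)

/-- The extension `h_μ` of the transition weight assignment `μ` to trees:
`h_μ(t → q)`. -/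
noncomputable def hmu [Fintype Q] [CommSemiring S]
    (μ : ∀ s : Sig, (Fin (ar s) → Q) → Q → S) : PTree Sig ar Q → Q → S
  | .state p, q => if p = q then 1 else 0
  | .node s ts, q => ∑ qs : Fin (ar s) → Q, μ s qs q * ∏ i, hmu μ (ts i) (qs i)

/-- The weighted tree language recognized by the wta `(Q, Σ, μ, F)`:
`M(t) = Σ_{q ∈ F} h_μ(t → q)`. -/
noncomputable def wtaSem [Fintype Q] [CommSemiring S]
    (μ : ∀ s : Sig, (Fin (ar s) → Q) → Q → S) (F : Finset Q)
    (t : PTree Sig ar Empty) : S :=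
  ∑ q ∈ F, hmu μ (PTree.ofClosed t) q

/-- Bottom-up determinism: every left-hand side `σ(q₁,…,q_k)` has at most one
target state with nonzero weight. -/
def Deterministic [CommSemiring S] (μ : ∀ s : Sig, (Fin (ar s) → Q) → Q → S) : Prop :=
  ∀ (s : Sig) (qs : Fin (ar s) → Q) (q q' : Q), μ s qs q ≠ 0 → μ s qs q' ≠ 0 → q = q'

/-- The pushed transition weight assignment
`μ'(σ(q₁,…,q_k) → q) = λ(q) · μ(σ(q₁,…,q_k) → q) · ∏ᵢ λ(qᵢ)⁻¹`. -/
noncomputable def push [Fintype Q] [Semifield S] (lam : Q → S)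
    (μ : ∀ s : Sig, (Fin (ar s) → Q) → Q → S) :
    ∀ s : Sig, (Fin (ar s) → Q) → Q → S :=
  fun s qs q => lam q * μ s qs q * ∏ i, (lam (qs i))⁻¹

/-- `h_μ^{(1)}(t) ∈ F` (for a deterministic wta): some final state is reached
with nonzero weight. -/
def finReach [Fintype Q] [CommSemiring S]
    (μ : ∀ s : Sig, (Fin (ar s) → Q) → Q → S) (F : Finset Q)
    (t : PTree Sig ar Q) : Prop :=
  ∃ q ∈ F, hmu μ t q ≠ 0

/-- `h_μ^{(2)}(t) · χ_F(h_μ^{(1)}(t))` (for a deterministic wta); an undefined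
value counts as `0`. -/
noncomputable def cweight [Fintype Q] [CommSemiring S]
    (μ : ∀ s : Sig, (Fin (ar s) → Q) → Q → S) (F : Finset Q)
    (t : PTree Sig ar Q) : S :=
  ∑ q ∈ F, hmu μ t q

/-- `h_μ^{(2)}(t)` (for a deterministic wta); an undefined value counts as `0`. -/
noncomputable def tweight [Fintype Q] [CommSemiring S]
    (μ : ∀ s : Sig, (Fin (ar s) → Q) → Q → S) (t : PTree Sig ar Q) : S :=
  ∑ q, hmu μ t q

/-- A context `c` is a sign of life for the state `q` if `h_μ^{(1)}(c[q]) ∈ F`. -/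
def SignOfLife [Fintype Q] [CommSemiring S]
    (μ : ∀ s : Sig, (Fin (ar s) → Q) → Q → S) (F : Finset Q)
    (c : Ctx Sig ar Q) (q : Q) : Prop :=
  finReach μ F (c.subst (.state q))

/-- A state is live if it has a sign of life. -/
def Live [Fintype Q] [CommSemiring S]
    (μ : ∀ s : Sig, (Fin (ar s) → Q) → Q → S) (F : Finset Q) (q : Q) : Prop :=
  ∃ c : Ctx Sig ar Q, SignOfLife μ F c q

/-- Weak equivalence `q₁ ∼_M q₂`. -/
def WeakEquiv [Fintype Q] [CommSemiring S]
    (μ : ∀ s : Sig, (Fin (ar s) → Q) → Q → S) (F : Finset Q)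
    (q₁ q₂ : Q) : Prop :=
  ∀ c : Ctx Sig ar Q,
    finReach μ F (c.subst (.state q₁)) ↔ finReach μ F (c.subst (.state q₂))

/-- Myhill–Nerode equivalence `q₁ ≡_M q₂`: there is a nonzero factor `s` with
`h_μ^{(2)}(c[q₁])·χ_F(h_μ^{(1)}(c[q₁])) = s · h_μ^{(2)}(c[q₂])·χ_F(h_μ^{(1)}(c[q₂]))`
for all contexts `c`. -/
def MNEquiv [Fintype Q] [CommSemiring S]
    (μ : ∀ s : Sig, (Fin (ar s) → Q) → Q → S) (F : Finset Q)
    (q₁ q₂ : Q) : Prop :=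
  ∃ s : S, s ≠ 0 ∧ ∀ c : Ctx Sig ar Q,
    cweight μ F (c.subst (.state q₁)) = s * cweight μ F (c.subst (.state q₂))

/-- `r` is a congruence of the dwta: equivalent left-hand sides have equivalent
targets (`μ^{(1)}`-values), where two undefined values are regarded as
equivalent and an undefined value is never equivalent to a defined one. -/
def IsCongruence [Fintype Q] [CommSemiring S]
    (μ : ∀ s : Sig, (Fin (ar s) → Q) → Q → S) (r : Q → Q → Prop) : Prop :=
  ∀ (s : Sig) (qs qs' : Fin (ar s) → Q), (∀ i, r (qs i) (qs' i)) →
    ((∃ q, μ s qs q ≠ 0) ↔ (∃ q, μ s qs' q ≠ 0)) ∧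
    (∀ q q', μ s qs q ≠ 0 → μ s qs' q' ≠ 0 → r q q')

/-- `r` respects `F`: every class lies inside `F` or outside `F`. -/
def Respects (r : Q → Q → Prop) (F : Finset Q) : Prop :=
  ∀ q q', r q q' → (q ∈ F ↔ q' ∈ F)

/-- Accessibility: every state is reached by some (closed) tree. -/
def Accessible [Fintype Q] [CommSemiring S]
    (μ : ∀ s : Sig, (Fin (ar s) → Q) → Q → S) : Prop :=
  ∀ q : Q, ∃ t : PTree Sig ar Empty, hmu μ (PTree.ofClosed t) q ≠ 0

/-- The transition weight assignment of the alphabetic dwta `syn(N)` over the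
ranked alphabet `Σ × S` (where `⟨σ, s⟩` has the rank of `σ`):
`ν''(⟨σ,s⟩(q₁,…,q_k) → q) = 1` iff `ν(σ(q₁,…,q_k) → q) = s ≠ 0`. -/
noncomputable def synMu [Fintype Q] [CommSemiring S]
    (ν : ∀ s : Sig, (Fin (ar s) → Q) → Q → S) :
    ∀ p : Sig × S, (Fin ((fun p : Sig × S => ar p.1) p) → Q) → Q → S :=
  fun p qs q => if ν p.1 qs q = p.2 ∧ p.2 ≠ 0 then 1 else 0

/-- Runs of the unweighted tree automaton `unw(M)` with transitions `supp(μ)`: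
`Reach μ t q` iff `unw(M)` can reach state `q` on the tree `t`. -/
inductive Reach [CommSemiring S] (μ : ∀ s : Sig, (Fin (ar s) → Q) → Q → S) :
    PTree Sig ar Q → Q → Prop where
  | state (q : Q) : Reach μ (.state q) q
  | node {s : Sig} (ts : Fin (ar s) → PTree Sig ar Q) (qs : Fin (ar s) → Q) (q : Q)
      (h : μ s qs q ≠ 0) (hc : ∀ i, Reach μ (ts i) (qs i)) : Reach μ (.node s ts) q

/-- Composition of contexts: `(C.comp D)[t] = C[D[t]]`. -/
def Ctx.comp : Ctx Sig ar Q → Ctx Sig ar Q → Ctx Sig ar Q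
  | .hole, D => D
  | .node s i ts c, D => .node s i ts (c.comp D)

theorem Ctx.subst_comp (C D : Ctx Sig ar Q) (t : PTree Sig ar Q) :
    (C.comp D).subst t = C.subst (D.subst t) := by
  induction C with
  | hole => rfl
  | node s i ts c ih => simp only [Ctx.comp, Ctx.subst, ih]

theorem prod_hmu_update [Fintype Q] [CommSemiring S]
    (μ : ∀ s : Sig, (Fin (ar s) → Q) → Q → S) {s : Sig} (ts : Fin (ar s) → PTree Sig ar Q)
    (i : Fin (ar s)) (t : PTree Sig ar Q) (rs : Fin (ar s) → Q) :
    ∏ j, hmu μ (Function.update ts i t j) (rs j) =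
      hmu μ t (rs i) * ∏ j ∈ Finset.univ.erase i, hmu μ (ts j) (rs j) := by
  rw [← Finset.mul_prod_erase _ _ (Finset.mem_univ i), Function.update_self]
  congr 1
  refine Finset.prod_congr rfl fun j hj => ?_
  rw [Function.update_of_ne (Finset.ne_of_mem_erase hj)]

theorem hmu_subst [Fintype Q] [CommSemiring S]
    (μ : ∀ s : Sig, (Fin (ar s) → Q) → Q → S) (c : Ctx Sig ar Q) (t : PTree Sig ar Q) (q : Q) :
    hmu μ (c.subst t) q = ∑ p, hmu μ t p * hmu μ (c.subst (.state p)) q := by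
  induction c generalizing q with
  | hole => simp [Ctx.subst, hmu]
  | node s i ts c ih =>
    simp only [Ctx.subst, hmu, prod_hmu_update, Finset.mul_sum]
    rw [Finset.sum_comm]
    refine Finset.sum_congr rfl fun rs _ => ?_
    rw [ih, Finset.sum_mul, Finset.mul_sum]
    exact Finset.sum_congr rfl fun p _ => by ring

theorem hmu_node_state [Fintype Q] [CommSemiring S]
    (μ : ∀ s : Sig, (Fin (ar s) → Q) → Q → S) (s : Sig) (qs : Fin (ar s) → Q) (q : Q) :
    hmu μ (.node s fun i => .state (qs i)) q = μ s qs q := by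
  simp only [hmu]
  rw [Finset.sum_eq_single qs]
  · simp
  · intro rs _ hrs
    obtain ⟨i, hi⟩ := Function.ne_iff.mp hrs
    rw [Finset.prod_eq_zero (Finset.mem_univ i) (if_neg hi.symm), mul_zero]
  · simp

theorem cweight_subst_node_state [Fintype Q] [CommSemiring S]
    (μ : ∀ s : Sig, (Fin (ar s) → Q) → Q → S) (F : Finset Q) (C : Ctx Sig ar Q)
    (s : Sig) (qs : Fin (ar s) → Q) :
    cweight μ F (C.subst (.node s fun i => .state (qs i))) =
      ∑ p, μ s qs p * cweight μ F (C.subst (.state p)) := by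
  simp only [cweight, Finset.mul_sum]
  rw [Finset.sum_comm]
  refine Finset.sum_congr rfl fun q _ => ?_
  rw [hmu_subst]
  exact Finset.sum_congr rfl fun p _ => by rw [hmu_node_state]

theorem Deterministic.hmu_unique [Fintype Q] [CommSemiring S]
    {μ : ∀ s : Sig, (Fin (ar s) → Q) → Q → S} (hdet : Deterministic μ) (t : PTree Sig ar Q)
    {q q' : Q} (h : hmu μ t q ≠ 0) (h' : hmu μ t q' ≠ 0) : q = q' := by
  induction t generalizing q q' with
  | state p =>
    simp only [hmu, ne_eq, ite_eq_right_iff, not_forall] at h h'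
    exact h.1.symm.trans h'.1
  | node s ts ih =>
    simp only [hmu] at h h'
    obtain ⟨rs, -, hr⟩ := Finset.exists_ne_zero_of_sum_ne_zero h
    obtain ⟨rs', -, hr'⟩ := Finset.exists_ne_zero_of_sum_ne_zero h'
    have hrs : rs = rs' := funext fun i => ih i
      (fun h0 => right_ne_zero_of_mul hr (Finset.prod_eq_zero (Finset.mem_univ i) h0))
      (fun h0 => right_ne_zero_of_mul hr' (Finset.prod_eq_zero (Finset.mem_univ i) h0))
    subst hrs
    exact hdet s rs q q' (left_ne_zero_of_mul hr) (left_ne_zero_of_mul hr')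

theorem Deterministic.finReach_iff [Fintype Q] [CommSemiring S]
    {μ : ∀ s : Sig, (Fin (ar s) → Q) → Q → S} (hdet : Deterministic μ) (F : Finset Q)
    (t : PTree Sig ar Q) : finReach μ F t ↔ cweight μ F t ≠ 0 := by
  constructor
  · rintro ⟨q, hq, hne⟩
    rw [cweight, Finset.sum_eq_single_of_mem q hq]
    · exact hne
    · intro b _ hb
      by_contra h0
      exact hb (hdet.hmu_unique t h0 hne)
  · intro h
    obtain ⟨q, hq, hne⟩ := Finset.exists_ne_zero_of_sum_ne_zero h
    exact ⟨q, hq, hne⟩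

theorem Deterministic.tweight_eq_cweight [Fintype Q] [CommSemiring S]
    {μ : ∀ s : Sig, (Fin (ar s) → Q) → Q → S} (hdet : Deterministic μ) {F : Finset Q}
    {t : PTree Sig ar Q} (h : finReach μ F t) : tweight μ t = cweight μ F t := by
  obtain ⟨q, hq, hne⟩ := h
  refine (Finset.sum_subset (Finset.subset_univ F) fun b _ hb => ?_).symm
  by_contra h0
  exact hb (hdet.hmu_unique t h0 hne ▸ hq)

theorem Deterministic.sum_mul_eq [Fintype Q] [CommSemiring S]
    {μ : ∀ s : Sig, (Fin (ar s) → Q) → Q → S} (hdet : Deterministic μ) {s : Sig}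
    {qs : Fin (ar s) → Q} {p : Q} (hp : μ s qs p ≠ 0) (f : Q → S) :
    ∑ q, μ s qs q * f q = μ s qs p * f p := by
  refine Finset.sum_eq_single_of_mem p (Finset.mem_univ p) fun b _ hb => ?_
  by_cases h0 : μ s qs b = 0
  · rw [h0, zero_mul]
  · exact absurd (hdet s qs b p h0 hp) hb

theorem Deterministic.weakEquiv_of_mul_cweight_eq [Fintype Q] [Semifield S]
    {μ : ∀ s : Sig, (Fin (ar s) → Q) → Q → S} (hdet : Deterministic μ) {F : Finset Q}
    {q q' : Q} {a b : S} (ha : a ≠ 0) (hb : b ≠ 0)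
    (h : ∀ c : Ctx Sig ar Q,
      a * cweight μ F (c.subst (.state q)) = b * cweight μ F (c.subst (.state q'))) :
    WeakEquiv μ F q q' := by
  intro c
  rw [hdet.finReach_iff, hdet.finReach_iff, ← mul_ne_zero_iff_left ha,
    ← mul_ne_zero_iff_left (b := cweight μ F (c.subst (.state q'))) hb, h c]

/-- Replacing the states of a left-hand side by equivalent ones scales the weight in every
context by the product of the individual factors. -/
theorem cweight_subst_node_eq_prod_mul [Fintype Q] [CommSemiring S]
    (μ : ∀ s : Sig, (Fin (ar s) → Q) → Q → S) (F : Finset Q) {s : Sig}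
    {qs qs' : Fin (ar s) → Q} {a : Fin (ar s) → S}
    (h : ∀ i, ∀ c : Ctx Sig ar Q, cweight μ F (c.subst (.state (qs i))) =
      a i * cweight μ F (c.subst (.state (qs' i)))) (C : Ctx Sig ar Q) :
    cweight μ F (C.subst (.node s fun i => .state (qs i))) =
      (∏ i, a i) * cweight μ F (C.subst (.node s fun i => .state (qs' i))) := by
  have key : ∀ T : Finset (Fin (ar s)),
      cweight μ F (C.subst (.node s fun i => .state (if i ∈ T then qs i else qs' i))) =
        (∏ i ∈ T, a i) * cweight μ F (C.subst (.node s fun i => .state (qs' i))) := by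
    intro T
    induction T using Finset.induction_on with
    | empty => simp
    | insert j T hj ih =>
      have hstep := h j (C.comp (.node s j
        (fun i => .state (if i ∈ T then qs i else qs' i)) .hole))
      simp only [Ctx.subst_comp, Ctx.subst] at hstep
      rw [Finset.prod_insert hj, mul_assoc, ← ih]
      convert hstep using 4
      · funext i
        by_cases hi : i = j
        · subst hi; simp
        · simp [hi]
      · congr 1
        funext i
        by_cases hi : i = j
        · subst hi; simp [hj]
        · simp [hi]
  simpa using key Finset.univ

theorem exists_transition_of_cweight_eq [Fintype Q] [Semifield S]
    {μ : ∀ s : Sig, (Fin (ar s) → Q) → Q → S} {F : Finset Q} (hdet : Deterministic μ)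
    (hlive : ∀ q : Q, Live μ F q) {s : Sig} {qs qs' : Fin (ar s) → Q} {a : S}
    (h : ∀ C : Ctx Sig ar Q, cweight μ F (C.subst (.node s fun i => .state (qs i))) =
      a * cweight μ F (C.subst (.node s fun i => .state (qs' i))))
    (hq : ∃ q, μ s qs q ≠ 0) : ∃ q, μ s qs' q ≠ 0 := by
  obtain ⟨p, hp⟩ := hq
  obtain ⟨C, hC⟩ := hlive p
  have hC' := (hdet.finReach_iff F _).mp hC
  have hne := mul_ne_zero hp hC'
  rw [← hdet.sum_mul_eq hp fun p => cweight μ F (C.subst (.state p)),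
    ← cweight_subst_node_state, h C, cweight_subst_node_state] at hne
  obtain ⟨p', -, hp'⟩ := Finset.exists_ne_zero_of_sum_ne_zero (right_ne_zero_of_mul hne)
  exact ⟨p', left_ne_zero_of_mul hp'⟩

theorem push_ne_zero_iff [Fintype Q] [Semifield S] {lam : Q → S} (hlam : ∀ q, lam q ≠ 0)
    (μ : ∀ s : Sig, (Fin (ar s) → Q) → Q → S) (s : Sig) (qs : Fin (ar s) → Q) (q : Q) :
    push lam μ s qs q ≠ 0 ↔ μ s qs q ≠ 0 := by
  have hprod : ∏ i, (lam (qs i))⁻¹ ≠ 0 :=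
    Finset.prod_ne_zero_iff.mpr fun i _ => inv_ne_zero (hlam _)
  simp only [push, ne_eq, mul_eq_zero, hlam, hprod, false_or, or_false]

theorem Deterministic.sum_push_eq [Fintype Q] [Semifield S]
    {μ : ∀ s : Sig, (Fin (ar s) → Q) → Q → S} (hdet : Deterministic μ) (lam : Q → S) {s : Sig}
    {qs : Fin (ar s) → Q} {p : Q} (hp : μ s qs p ≠ 0) :
    ∑ q, push lam μ s qs q = μ s qs p * lam p * ∏ i, (lam (qs i))⁻¹ := by
  simp only [push]
  rw [← Finset.sum_mul, ← hdet.sum_mul_eq hp lam]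
  simp only [mul_comm]

/-- For a dwta with all states live and pushing weights
`λ(q) = h_μ^{(2)}(sol([q]_{∼_M})[q])`, the pushed weights of corresponding
transitions on `≡_M`-equivalent left-hand sides coincide (and both sides are
undefined simultaneously). -/
theorem pushed_weights_coincide {Sig Q S : Type} {ar : Sig → ℕ}
    [Fintype Q] [Semifield S]
    (μ : ∀ s : Sig, (Fin (ar s) → Q) → Q → S) (F : Finset Q)
    (hdet : Deterministic μ)
    (hlive : ∀ q : Q, Live μ F q)
    (sol : Q → Ctx Sig ar Q)
    (hsol : ∀ q : Q, SignOfLife μ F (sol q) q)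
    (hsolF : ∀ q ∈ F, sol q = Ctx.hole)
    (hsolcl : ∀ q q' : Q, WeakEquiv μ F q q' → sol q = sol q')
    (lam : Q → S) (hlam : ∀ q : Q, lam q = tweight μ ((sol q).subst (.state q)))
    (s : Sig) (qs qs' : Fin (ar s) → Q)
    (h : ∀ i, MNEquiv μ F (qs i) (qs' i)) :
    ((∃ q, push lam μ s qs q ≠ 0) ↔ (∃ q, push lam μ s qs' q ≠ 0)) ∧
    (∑ q, push lam μ s qs q) = ∑ q, push lam μ s qs' q := by
  have hlam' : ∀ q, lam q = cweight μ F ((sol q).subst (.state q)) := fun q =>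
    (hlam q).trans (hdet.tweight_eq_cweight (hsol q))
  have hlam0 : ∀ q, lam q ≠ 0 := fun q =>
    hlam' q ▸ (hdet.finReach_iff F _).mp (hsol q)
  choose a ha0 ha using h
  have hfactor : ∀ i, lam (qs i) = a i * lam (qs' i) := by
    intro i
    have hw : WeakEquiv μ F (qs i) (qs' i) :=
      hdet.weakEquiv_of_mul_cweight_eq one_ne_zero (ha0 i) fun c => by rw [one_mul, ha i c]
    rw [hlam' (qs i), hlam' (qs' i), ← hsolcl _ _ hw, ha i]
  have hnode := cweight_subst_node_eq_prod_mul μ F ha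
  have hprod0 : ∏ i, a i ≠ 0 := Finset.prod_ne_zero_iff.mpr fun i _ => ha0 i
  have hiff : (∃ q, μ s qs q ≠ 0) ↔ (∃ q, μ s qs' q ≠ 0) :=
    ⟨exists_transition_of_cweight_eq hdet hlive hnode,
      exists_transition_of_cweight_eq (a := (∏ i, a i)⁻¹) hdet hlive fun C => by
        rw [hnode C, inv_mul_cancel_left₀ hprod0]⟩
  refine ⟨by simpa only [push_ne_zero_iff hlam0] using hiff, ?_⟩
  by_cases hex : ∃ q, μ s qs q ≠ 0
  · obtain ⟨p', hp'⟩ := hiff.mp hex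
    obtain ⟨p, hp⟩ := hex
    have hpp : ∀ C : Ctx Sig ar Q, μ s qs p * cweight μ F (C.subst (.state p)) =
        (∏ i, a i) * μ s qs' p' * cweight μ F (C.subst (.state p')) := by
      intro C
      have hC := hnode C
      rw [cweight_subst_node_state, cweight_subst_node_state,
        hdet.sum_mul_eq hp fun p => cweight μ F (C.subst (.state p)),
        hdet.sum_mul_eq hp' fun p => cweight μ F (C.subst (.state p)), ← mul_assoc] at hC
      exact hC
    have hw : WeakEquiv μ F p p' :=
      hdet.weakEquiv_of_mul_cweight_eq hp (mul_ne_zero hprod0 hp') hpp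
    have hl : μ s qs p * lam p = (∏ i, a i) * μ s qs' p' * lam p' := by
      rw [hlam' p, hlam' p', ← hsolcl _ _ hw, hpp]
    rw [hdet.sum_push_eq lam hp, hdet.sum_push_eq lam hp', hl]
    simp only [hfactor, Finset.prod_inv_distrib, Finset.prod_mul_distrib, mul_inv]
    rw [mul_assoc (∏ i, a i), mul_mul_mul_comm, mul_inv_cancel₀ hprod0, one_mul]
  · have hex' := mt hiff.mpr hex
    push Not at hex hex'
    simp [push, hex, hex']

end WTA
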